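/- Let 0 < α ≤ 1 and λ₁ > 1. The function w(t) = (λ₁² − E_α((1−λ₁²) t^α))/(λ₁² − 1) is the unique continuous solution on (0,T] of the Volterra integral equation w(t) − ∫₀^t (t−τ)^{α−1} E_{α,α}(−λ₁²(t−τ)^α) w(τ) dτ = 1. -/

import Mathlib

open Real Set intervalIntegral

/-- The two-parameter Mittag-Leffler function. -/
noncomputable def mlE (α β z : ℝ) : ℝ := ∑' k : ℕ, z ^ k / Real.Gamma (α * k + β)

open MeasureTheory Filter Topology

lemma rpow_mul_exp_neg_le_Gamma {M x : ℝ} (hM : 0 < M) (hx : 1 ≤ x) :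
    M ^ (x - 1) * Real.exp (-M) ≤ Real.Gamma x := by
  have hint := Real.GammaIntegral_convergent (show 0 < x by linarith)
  rw [Real.Gamma_eq_integral (by linarith), ← integral_exp_neg_Ioi M, ← MeasureTheory.integral_const_mul]
  calc ∫ y in Ioi M, M ^ (x - 1) * Real.exp (-y)
      ≤ ∫ y in Ioi M, Real.exp (-y) * y ^ (x - 1) := by
        refine setIntegral_mono_on ?_ (hint.mono_set (Ioi_subset_Ioi hM.le))
          measurableSet_Ioi fun y hy => ?_
        · exact ((exp_neg_integrableOn_Ioi M one_pos).congr_fun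
            (fun y _ => by simp) measurableSet_Ioi).const_mul _
        · rw [mul_comm]
          have : M ^ (x - 1) ≤ y ^ (x - 1) :=
            Real.rpow_le_rpow hM.le (le_of_lt hy) (by linarith)
          gcongr
    _ ≤ ∫ y in Ioi 0, Real.exp (-y) * y ^ (x - 1) := by
        refine setIntegral_mono_set hint ?_ (Ioi_subset_Ioi hM.le).eventuallyLE
        filter_upwards [ae_restrict_mem measurableSet_Ioi] with y hy
        have : (0 : ℝ) < y := hy
        simp only [Pi.zero_apply]
        positivity

lemma summable_mlE {α β : ℝ} (hα : 0 < α) (z : ℝ) :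
    Summable fun k : ℕ => z ^ k / Real.Gamma (α * k + β) := by
  set M : ℝ := (2 * (|z| + 1)) ^ (1 / α) with hMdef
  have hz : 0 < 2 * (|z| + 1) := by positivity
  have hM : 0 < M := Real.rpow_pos_of_pos hz _
  have hMα : M ^ α = 2 * (|z| + 1) := by
    rw [hMdef, ← Real.rpow_mul hz.le, one_div_mul_cancel hα.ne', Real.rpow_one]
  have hg : Summable fun k : ℕ => (Real.exp M / M ^ (β - 1)) * (1 / 2 : ℝ) ^ k :=
    (summable_geometric_of_lt_one (by norm_num) (by norm_num)).mul_left _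
  refine Summable.of_norm_bounded_eventually_nat hg ?_
  have htend : Tendsto (fun k : ℕ => α * (k : ℝ) + β) atTop atTop :=
    tendsto_atTop_add_const_right _ _ (tendsto_natCast_atTop_atTop.const_mul_atTop hα)
  filter_upwards [htend.eventually_ge_atTop 1] with k hk
  have h1 := rpow_mul_exp_neg_le_Gamma hM hk
  have h2 : M ^ (α * (k : ℝ) + β - 1) = (2 * (|z| + 1)) ^ k * M ^ (β - 1) := by
    rw [add_sub_assoc, Real.rpow_add hM, Real.rpow_mul hM.le, hMα, Real.rpow_natCast]
  rw [h2] at h1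
  have hMβ : 0 < M ^ (β - 1) := Real.rpow_pos_of_pos hM _
  have hΓ : 0 < Real.Gamma (α * (k : ℝ) + β) := Real.Gamma_pos_of_pos (by linarith)
  rw [norm_div, norm_pow, Real.norm_eq_abs, Real.norm_of_nonneg hΓ.le, div_le_iff₀ hΓ]
  calc |z| ^ k ≤ (|z| + 1) ^ k := by gcongr; linarith
    _ = (Real.exp M / M ^ (β - 1)) * (1 / 2 : ℝ) ^ k *
          ((2 * (|z| + 1)) ^ k * M ^ (β - 1) * Real.exp (-M)) := by
        rw [Real.exp_neg, mul_pow]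
        field_simp
        rw [← mul_pow]; norm_num
    _ ≤ _ := by gcongr

lemma continuous_mlE {α β : ℝ} (hα : 0 < α) : Continuous (mlE α β) := by
  rw [continuous_iff_continuousAt]
  intro x
  have hs : Summable fun k : ℕ => |(|x| + 1) ^ k / Real.Gamma (α * k + β)| :=
    (summable_mlE hα _).abs
  have : ContinuousOn (mlE α β) (Metric.closedBall 0 (|x| + 1)) := by
    refine continuousOn_tsum (fun k => by fun_prop) hs fun k y hy => ?_
    rw [mem_closedBall_zero_iff, Real.norm_eq_abs] at hy
    rw [norm_div, norm_pow, abs_div, abs_pow, abs_of_nonneg (show 0 ≤ |x| + 1 by positivity)]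
    simp only [Real.norm_eq_abs]
    gcongr
  refine this.continuousAt (Metric.closedBall_mem_nhds_of_mem ?_)
  simp

lemma integral_sub_rpow_mul_rpow {p q t : ℝ} (hp : 0 < p) (hq : 0 < q) (ht : 0 < t) :
    ∫ τ in (0 : ℝ)..t, (t - τ) ^ (p - 1) * τ ^ (q - 1) =
      Real.Gamma p * Real.Gamma q / Real.Gamma (p + q) * t ^ (p + q - 1) := by
  have h := Complex.betaIntegral_scaled (q : ℂ) (p : ℂ) ht
  rw [Complex.betaIntegral_eq_Gamma_mul_div _ _ (by simpa) (by simpa)] at h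
  have h1 : ∫ x in (0 : ℝ)..t, (x : ℂ) ^ ((q : ℂ) - 1) * ((t : ℂ) - x) ^ ((p : ℂ) - 1) =
      ((∫ τ in (0 : ℝ)..t, (t - τ) ^ (p - 1) * τ ^ (q - 1) : ℝ) : ℂ) := by
    rw [← intervalIntegral.integral_ofReal]
    refine intervalIntegral.integral_congr fun x hx => ?_
    rw [uIcc_of_le ht.le] at hx
    rw [Complex.ofReal_mul, Complex.ofReal_cpow (sub_nonneg.2 hx.2), Complex.ofReal_cpow hx.1]
    push_cast
    ring
  rw [h1, ← Complex.ofReal_add, Complex.Gamma_ofReal, Complex.Gamma_ofReal, Complex.Gamma_ofReal,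
    ← Complex.ofReal_one, ← Complex.ofReal_sub, ← Complex.ofReal_cpow ht.le] at h
  norm_cast at h
  rw [h, add_comm q p]
  ring

lemma intervalIntegrable_sub_rpow_mul_rpow {p q t : ℝ} (hp : 0 < p) (hq : 0 < q) (ht : 0 < t) :
    IntervalIntegrable (fun τ => (t - τ) ^ (p - 1) * τ ^ (q - 1)) volume 0 t := by
  by_contra h
  have h1 := integral_sub_rpow_mul_rpow hp hq ht
  rw [intervalIntegral.integral_undef h] at h1
  have := Real.Gamma_pos_of_pos hp
  have := Real.Gamma_pos_of_pos hq
  have := Real.Gamma_pos_of_pos (add_pos hp hq)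
  have := Real.rpow_pos_of_pos ht (p + q - 1)
  exact absurd h1 (by positivity)

lemma summable_pow_mul_pow_mul {G : ℕ → ℝ} (hG : ∀ z : ℝ, Summable fun n => z ^ n * G n)
    (a c : ℝ) : Summable fun x : ℕ × ℕ => a ^ x.1 * c ^ x.2 * G (x.1 + x.2) := by
  set m := max |a| |c|
  obtain ⟨C, hC⟩ := (hG (2 * m)).tendsto_atTop_zero.abs.bddAbove_range
  have hgeo : Summable fun n : ℕ => (1 / 2 : ℝ) ^ n :=
    summable_geometric_of_lt_one (by norm_num) (by norm_num)
  refine Summable.of_norm_bounded ((hgeo.mul_of_nonneg hgeo (fun _ => by positivity)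
    (fun _ => by positivity)).mul_left C) fun x => ?_
  have hx : |(2 * m) ^ (x.1 + x.2) * G (x.1 + x.2)| ≤ C := hC ⟨_, rfl⟩
  have hm : 0 ≤ m := le_max_of_le_left (abs_nonneg a)
  calc ‖a ^ x.1 * c ^ x.2 * G (x.1 + x.2)‖ = |a| ^ x.1 * |c| ^ x.2 * |G (x.1 + x.2)| := by
        simp
    _ ≤ m ^ x.1 * m ^ x.2 * |G (x.1 + x.2)| := by
        gcongr
        · exact le_max_left _ _
        · exact le_max_right _ _
    _ = |(2 * m) ^ (x.1 + x.2) * G (x.1 + x.2)| * ((1 / 2 : ℝ) ^ x.1 * (1 / 2 : ℝ) ^ x.2) := by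
        rw [abs_mul, abs_pow, abs_of_nonneg (show 0 ≤ 2 * m by positivity), ← pow_add, ← pow_add,
          mul_right_comm, ← mul_pow]
        ring_nf
    _ ≤ _ := by gcongr

lemma sub_mul_tsum_pow_mul_pow_mul {G : ℕ → ℝ} (hG : ∀ z : ℝ, Summable fun n => z ^ n * G n)
    (a c : ℝ) : (c - a) * ∑' x : ℕ × ℕ, a ^ x.1 * c ^ x.2 * G (x.1 + x.2) =
      ∑' n, (c ^ (n + 1) - a ^ (n + 1)) * G n := by
  have hs := summable_pow_mul_pow_mul hG a c
  have key : ∑' x : ℕ × ℕ, a ^ x.1 * c ^ x.2 * G (x.1 + x.2) =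
      ∑' n, ∑' x : Finset.HasAntidiagonal.antidiagonal n, a ^ x.1.1 * c ^ x.1.2 * G (x.1.1 + x.1.2) := by
    rw [← Finset.HasAntidiagonal.sigmaAntidiagonalEquivProd.tsum_eq]
    exact ((Finset.HasAntidiagonal.sigmaAntidiagonalEquivProd (A := ℕ)).summable_iff.2
      hs).tsum_sigma' (fun n => (hasSum_fintype _).summable)
  rw [key, ← tsum_mul_left]
  refine tsum_congr fun n => ?_
  rw [tsum_fintype, ← neg_sub a c, neg_mul]
  have h1 : ∀ x : Finset.HasAntidiagonal.antidiagonal n,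
      a ^ x.1.1 * c ^ x.1.2 * G (x.1.1 + x.1.2) = a ^ x.1.1 * c ^ x.1.2 * G n := by
    intro x
    rw [Finset.HasAntidiagonal.mem_antidiagonal.1 x.2]
  have h2 := (Commute.all a c).mul_geom_sum₂ (n + 1)
  rw [Finset.sum_congr rfl fun x _ => h1 x,
    Finset.sum_coe_sort (Finset.HasAntidiagonal.antidiagonal n) (fun x => a ^ x.1 * c ^ x.2 * G n),
    ← Finset.sum_mul, Finset.Nat.sum_antidiagonal_eq_sum_range_succ (fun i j => a ^ i * c ^ j) n,
    ← mul_assoc]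
  simp only [Nat.add_sub_cancel] at h2
  rw [h2]
  ring

lemma mlE_zero_right (α : ℝ) : mlE α 1 0 = 1 := by
  rw [mlE, tsum_eq_single 0 fun k hk => by simp [hk]]
  simp

lemma mlE_one_sub_one {α : ℝ} (hα : 0 < α) (z : ℝ) :
    mlE α 1 z - 1 = ∑' k : ℕ, z ^ (k + 1) / Real.Gamma (α * (k + 1) + 1) := by
  rw [mlE, (summable_mlE hα z).tsum_eq_zero_add]
  simp

lemma continuous_mlE_rpow {α β : ℝ} (hα : 0 < α) (c : ℝ) :
    Continuous fun s : ℝ => mlE α β (c * s ^ α) :=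
  (continuous_mlE hα).comp (continuous_const.mul
    (continuous_id.rpow_const fun _ => Or.inr hα.le))

lemma mul_pow_rpow {α s : ℝ} (hs : 0 ≤ s) (c : ℝ) (k : ℕ) :
    (c * s ^ α) ^ k = c ^ k * s ^ (α * k) := by
  rw [mul_pow, Real.rpow_mul hs, Real.rpow_natCast]

/-- The convolution of two Mittag-Leffler kernels is a divided difference. -/
lemma sub_mul_integral_mlE {α t : ℝ} (hα : 0 < α) (ht : 0 < t) (a c : ℝ) :
    (c - a) * ∫ τ in (0 : ℝ)..t,
        (t - τ) ^ (α - 1) * mlE α α (a * (t - τ) ^ α) * mlE α 1 (c * τ ^ α) =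
      mlE α 1 (c * t ^ α) - mlE α 1 (a * t ^ α) := by
  set G : ℕ → ℝ := fun n => t ^ (α * (n + 1)) / Real.Gamma (α * (n + 1) + 1) with hGdef
  have hG : ∀ z : ℝ, Summable fun n => z ^ n * G n := fun z => by
    refine ((summable_mlE (β := α + 1) hα (z * t ^ α)).mul_left (t ^ α)).congr fun n => ?_
    rw [mul_pow_rpow ht.le, hGdef]
    simp only
    rw [mul_add, mul_one, Real.rpow_add ht, add_assoc]
    ring
  have htail : ∀ z : ℝ, mlE α 1 (z * t ^ α) - 1 = ∑' n, z ^ (n + 1) * G n := fun z => by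
    rw [mlE_one_sub_one hα]
    refine tsum_congr fun n => ?_
    rw [mul_pow_rpow ht.le, hGdef]
    push_cast
    ring
  have hGs : ∀ z : ℝ, Summable fun n => z ^ (n + 1) * G n := fun z => by
    simpa only [pow_succ', mul_assoc] using (hG z).mul_left z
  set B : ℕ × ℕ → ℝ → ℝ := fun x τ =>
    ((t - τ) ^ (α * x.1 + α - 1) * τ ^ (α * x.2 + 1 - 1)) /
      (Real.Gamma (α * x.1 + α) * Real.Gamma (α * x.2 + 1)) with hBdef
  have hp : ∀ k : ℕ, 0 < α * k + α := fun k => by positivity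
  have hq : ∀ k : ℕ, 0 < α * k + 1 := fun k => by positivity
  have hBint : ∀ x, Integrable (B x) (volume.restrict (Ioo 0 t)) := fun x => by
    have := (intervalIntegrable_sub_rpow_mul_rpow (hp x.1) (hq x.2) ht).div_const
      (Real.Gamma (α * x.1 + α) * Real.Gamma (α * x.2 + 1))
    rwa [intervalIntegrable_iff_integrableOn_Ioo_of_le ht.le] at this
  have hBval : ∀ x : ℕ × ℕ, ∫ τ in Ioo 0 t, B x τ = G (x.1 + x.2) := fun x => by
    rw [← integral_Ioc_eq_integral_Ioo, ← intervalIntegral.integral_of_le ht.le, hBdef]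
    simp only
    rw [intervalIntegral.integral_div, integral_sub_rpow_mul_rpow (hp x.1) (hq x.2) ht, hGdef]
    have h1 := (Real.Gamma_pos_of_pos (hp x.1)).ne'
    have h2 := (Real.Gamma_pos_of_pos (hq x.2)).ne'
    have e : α * (x.1 : ℝ) + α + (α * x.2 + 1) = α * (((x.1 + x.2 : ℕ) : ℝ) + 1) + 1 := by
      push_cast; ring
    rw [e]
    simp only [add_sub_cancel_right]
    field_simp
  have hBnonneg : ∀ x, ∀ τ ∈ Ioo 0 t, 0 ≤ B x τ := fun x τ hτ => by
    have h1 := Real.Gamma_pos_of_pos (hp x.1)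
    have h2 := Real.Gamma_pos_of_pos (hq x.2)
    have h3 := Real.rpow_nonneg (sub_nonneg.2 hτ.2.le) (α * x.1 + α - 1)
    have h4 := Real.rpow_nonneg hτ.1.le (α * x.2 + 1 - 1)
    simp only [hBdef]
    positivity
  have hnorm : ∀ x : ℕ × ℕ, ∫ τ in Ioo 0 t, ‖a ^ x.1 * c ^ x.2 * B x τ‖ =
      |a| ^ x.1 * |c| ^ x.2 * G (x.1 + x.2) := fun x => by
    rw [← hBval, ← MeasureTheory.integral_const_mul]
    refine setIntegral_congr_fun measurableSet_Ioo fun τ hτ => ?_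
    simp [abs_of_nonneg (hBnonneg x τ hτ)]
  have hsum := hasSum_integral_of_summable_integral_norm
    (F := fun (x : ℕ × ℕ) τ => a ^ x.1 * c ^ x.2 * B x τ)
    (fun x => (hBint x).const_mul _)
    ((summable_pow_mul_pow_mul hG |a| |c|).congr fun x => (hnorm x).symm)
  simp only [MeasureTheory.integral_const_mul, hBval] at hsum
  have hint : ∫ τ in Ioo 0 t, ∑' x : ℕ × ℕ, a ^ x.1 * c ^ x.2 * B x τ =
      ∫ τ in (0 : ℝ)..t,
        (t - τ) ^ (α - 1) * mlE α α (a * (t - τ) ^ α) * mlE α 1 (c * τ ^ α) := by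
    rw [intervalIntegral.integral_of_le ht.le, integral_Ioc_eq_integral_Ioo]
    refine setIntegral_congr_fun measurableSet_Ioo fun τ hτ => ?_
    have hτ' : 0 < t - τ := sub_pos.2 hτ.2
    simp only [mlE]
    rw [mul_assoc, tsum_mul_tsum_of_summable_norm (summable_mlE hα _).norm
      (summable_mlE hα _).norm, ← tsum_mul_left]
    refine tsum_congr fun x => ?_
    rw [mul_pow_rpow hτ'.le, mul_pow_rpow hτ.1.le, hBdef]
    simp only [add_sub_cancel_right, add_sub_assoc]
    rw [Real.rpow_add hτ']
    ring
  rw [← hint, ← hsum.tsum_eq, sub_mul_tsum_pow_mul_pow_mul hG]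
  simp only [sub_mul]
  rw [(hGs c).tsum_sub (hGs a), ← htail, ← htail]
  ring

lemma intervalIntegrable_rpow_mul_mlE {α : ℝ} (hα : 0 < α) (a x y : ℝ) :
    IntervalIntegrable (fun s : ℝ => s ^ (α - 1) * mlE α α (a * s ^ α)) volume x y :=
  (intervalIntegral.intervalIntegrable_rpow' (by linarith)).mul_continuousOn
    (continuous_mlE_rpow hα a).continuousOn

lemma intervalIntegrable_comp_sub_left {k : ℝ → ℝ} {t x y : ℝ}
    (hk : ∀ x y, IntervalIntegrable k volume x y) :
    IntervalIntegrable (fun τ => k (t - τ)) volume x y := by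
  simpa using (hk (t - x) (t - y)).comp_sub_left t

lemma exists_exp_weight_integral_lt_one {k : ℝ → ℝ} {T : ℝ} (hT : 0 < T)
    (hk : IntervalIntegrable k volume 0 T) :
    ∃ M : ℝ, ∫ s in Ioc 0 T, Real.exp (-(M * s)) * |k s| < 1 := by
  rw [intervalIntegrable_iff_integrableOn_Ioc_of_le hT.le] at hk
  have hlim : Tendsto (fun n : ℕ => ∫ s in Ioc 0 T, Real.exp (-((n : ℝ) * s)) * |k s|) atTop
      (𝓝 (∫ _ in Ioc 0 T, (0 : ℝ))) := by
    refine tendsto_integral_of_dominated_convergence (fun s => |k s|) (fun n => ?_) hk.abs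
      (fun n => ?_) ?_
    · exact (by fun_prop : Continuous fun s : ℝ => Real.exp (-((n : ℝ) * s))).aestronglyMeasurable.mul
        hk.abs.aestronglyMeasurable
    · filter_upwards [ae_restrict_mem measurableSet_Ioc] with s hs
      have hs0 : 0 ≤ (n : ℝ) * s := mul_nonneg n.cast_nonneg hs.1.le
      rw [norm_mul, Real.norm_eq_abs, Real.norm_eq_abs, abs_abs, Real.abs_exp]
      exact mul_le_of_le_one_left (abs_nonneg _) (Real.exp_le_one_iff.2 (by linarith))
    · filter_upwards [ae_restrict_mem measurableSet_Ioc] with s hs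
      have h1 : Tendsto (fun n : ℕ => Real.exp (-((n : ℝ) * s))) atTop (𝓝 0) :=
        Real.tendsto_exp_neg_atTop_nhds_zero.comp
          (tendsto_natCast_atTop_atTop.atTop_mul_const hs.1)
      simpa using h1.mul_const |k s|
  rw [integral_zero] at hlim
  obtain ⟨n, hn⟩ := (hlim.eventually_lt_const one_pos).exists
  exact ⟨n, hn⟩

open scoped Convolution in
/-- A homogeneous linear Volterra equation of convolution type has only the trivial integrable
solution. -/
lemma eqOn_zero_of_volterra {k u : ℝ → ℝ} {T : ℝ} (hT : 0 < T)
    (hk : IntervalIntegrable k volume 0 T) (hu : IntervalIntegrable u volume 0 T)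
    (h : ∀ t ∈ Ioc 0 T, u t = ∫ τ in (0 : ℝ)..t, k (t - τ) * u τ) : EqOn u 0 (Ioc 0 T) := by
  obtain ⟨M, hM⟩ := exists_exp_weight_integral_lt_one hT hk
  rw [intervalIntegrable_iff_integrableOn_Ioc_of_le hT.le] at hk hu
  have hweight : ∀ {v : ℝ → ℝ}, IntegrableOn v (Ioc 0 T) →
      IntegrableOn (fun s => Real.exp (-(M * s)) * |v s|) (Ioc 0 T) := fun hv =>
    IntegrableOn.continuousOn_mul_of_subset
      (by fun_prop : Continuous fun s : ℝ => Real.exp (-(M * s))).continuousOn hv.abs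
      isCompact_Icc measurableSet_Ioc Ioc_subset_Icc_self
  set f : ℝ → ℝ := (Ioc 0 T).indicator fun s => Real.exp (-(M * s)) * |u s| with hf
  set g : ℝ → ℝ := (Ioc 0 T).indicator fun s => Real.exp (-(M * s)) * |k s| with hg
  have hfi : Integrable f := (hweight hu).integrable_indicator measurableSet_Ioc
  have hgi : Integrable g := (hweight hk).integrable_indicator measurableSet_Ioc
  have hf0 : ∀ s, 0 ≤ f s := fun s => indicator_nonneg (fun _ _ => by positivity) _
  have hg0 : ∀ s, 0 ≤ g s := fun s => indicator_nonneg (fun _ _ => by positivity) _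
  set L := ContinuousLinearMap.mul ℝ ℝ
  have hle : ∀ t, f t ≤ (f ⋆[L, volume] g) t := by
    intro t
    by_cases ht : t ∈ Ioc 0 T
    · have hpt : ∀ τ, L (f τ) (g (t - τ)) =
          (Ioo 0 t).indicator (fun τ => Real.exp (-(M * t)) * |k (t - τ) * u τ|) τ := by
        intro τ
        by_cases hτ : τ ∈ Ioo 0 t
        · have h1 : τ ∈ Ioc 0 T := ⟨hτ.1, hτ.2.le.trans ht.2⟩
          have h2 : t - τ ∈ Ioc 0 T := ⟨sub_pos.2 hτ.2, by linarith [hτ.1, ht.2]⟩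
          rw [indicator_of_mem hτ, hf, hg, indicator_of_mem h1, indicator_of_mem h2]
          have e : Real.exp (-(M * t)) = Real.exp (-(M * τ)) * Real.exp (-(M * (t - τ))) := by
            rw [← Real.exp_add]; ring_nf
          rw [e, abs_mul, ContinuousLinearMap.mul_apply']
          ring
        · rw [indicator_of_notMem hτ, ContinuousLinearMap.mul_apply']
          by_cases h1 : τ ∈ Ioc 0 T
          · have h2 : t - τ ∉ Ioc 0 T := fun h2 => hτ ⟨h1.1, sub_pos.1 h2.1⟩
            rw [hg, indicator_of_notMem h2, mul_zero]
          · rw [hf, indicator_of_notMem h1, zero_mul]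
      rw [convolution_def, integral_congr_ae (Eventually.of_forall hpt),
        MeasureTheory.integral_indicator measurableSet_Ioo, MeasureTheory.integral_const_mul, hf,
        indicator_of_mem ht, h t ht, intervalIntegral.integral_of_le ht.1.le,
        integral_Ioc_eq_integral_Ioo]
      exact mul_le_mul_of_nonneg_left (abs_integral_le_integral_abs) (Real.exp_pos _).le
    · rw [hf, indicator_of_notMem ht]
      exact integral_nonneg fun τ => mul_nonneg (hf0 _) (hg0 _)
  have hint : ∫ t, f t ≤ (∫ t, f t) * ∫ t, g t := by
    have h1 := integral_mono hfi (hfi.integrable_convolution L hgi) hle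
    rwa [integral_convolution L hfi hgi] at h1
  have hglt : ∫ t, g t < 1 := by rwa [hg, MeasureTheory.integral_indicator measurableSet_Ioc]
  have hfz : ∫ t, f t = 0 := by
    have h1 : 0 ≤ ∫ t, f t := integral_nonneg hf0
    nlinarith
  have hae : f =ᵐ[volume] 0 := (integral_eq_zero_iff_of_nonneg hf0 hfi).1 hfz
  intro t ht
  rw [h t ht, Pi.zero_apply]
  refine intervalIntegral.integral_zero_ae ?_
  filter_upwards [hae] with τ hτ hmem
  rw [uIoc_of_le ht.1.le] at hmem
  rw [hf, indicator_of_mem (show τ ∈ Ioc 0 T from ⟨hmem.1, hmem.2.trans ht.2⟩)] at hτ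
  have : u τ = 0 := by simpa [Real.exp_ne_zero] using hτ
  rw [this, mul_zero]

lemma intervalIntegrable_kernel_mul {k u : ℝ → ℝ} {T t : ℝ}
    (hk : ∀ x y, IntervalIntegrable k volume x y) (hkc : ContinuousOn k (Ioi 0))
    (huc : ContinuousOn u (Ioc 0 T)) (hu : IntervalIntegrable u volume 0 T) (ht : t ∈ Ioc 0 T) :
    IntervalIntegrable (fun τ => k (t - τ) * u τ) volume 0 t := by
  have ht2 : 0 < t / 2 := half_pos ht.1
  have hkt : ContinuousOn (fun τ => k (t - τ)) (uIcc 0 (t / 2)) :=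
    hkc.comp (by fun_prop) fun τ hτ => by
      rw [uIcc_of_le ht2.le] at hτ
      exact show 0 < t - τ by linarith [hτ.2]
  have hut : ContinuousOn u (uIcc (t / 2) t) := huc.mono fun τ hτ => by
    rw [uIcc_of_le (by linarith)] at hτ
    exact ⟨by linarith [hτ.1], hτ.2.trans ht.2⟩
  have hu' : IntervalIntegrable u volume 0 (t / 2) := hu.mono_set <| by
    rw [uIcc_of_le ht2.le, uIcc_of_le (by linarith [ht.1, ht.2])]
    exact Icc_subset_Icc_right (by linarith [ht.2])
  exact (hu'.continuousOn_mul hkt).trans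
    ((intervalIntegrable_comp_sub_left hk).mul_continuousOn hut)

/-- A solution of a Volterra equation that is continuous on `(0, T]` is integrable at the origin
when the kernel does not vanish near `0`: otherwise its Bochner integrals would all be `0` and the
solution would be constant. -/
lemma intervalIntegrable_of_volterra {k v : ℝ → ℝ} {T : ℝ} (hT : 0 < T)
    (hkc : ContinuousOn k (Ioi 0)) (hk0 : ∀ᶠ s in 𝓝[>] 0, k s ≠ 0)
    (hvc : ContinuousOn v (Ioc 0 T))
    (h : ∀ t ∈ Ioc 0 T, v t - ∫ τ in (0 : ℝ)..t, k (t - τ) * v τ = 1) :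
    IntervalIntegrable v volume 0 T := by
  by_contra hv
  obtain ⟨δ, hδ, hδk⟩ := mem_nhdsGT_iff_exists_Ioc_subset.1 hk0
  have hδ0 : 0 < δ := hδ
  set ε := min δ T with hε
  have hε0 : 0 < ε := lt_min hδ0 hT
  have hnot : ∀ t ∈ Ioc 0 T, ¬ IntervalIntegrable v volume 0 t := fun t ht hvt => by
    refine hv (hvt.trans (ContinuousOn.intervalIntegrable (hvc.mono fun τ hτ => ?_)))
    rw [uIcc_of_le ht.2] at hτ
    exact ⟨ht.1.trans_le hτ.1, hτ.2⟩
  have hone : ∀ t ∈ Ioc 0 ε, v t = 1 := by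
    intro t ht
    have htT : t ≤ T := ht.2.trans (min_le_right _ _)
    have htδ : t ≤ δ := ht.2.trans (min_le_left _ _)
    have ht2 : 0 < t / 2 := half_pos ht.1
    have hmem : ∀ τ ∈ uIcc 0 (t / 2), t - τ ∈ Ioc 0 δ := fun τ hτ => by
      rw [uIcc_of_le ht2.le] at hτ
      exact ⟨by linarith [hτ.2], by linarith [hτ.1]⟩
    have hni : ¬ IntervalIntegrable (fun τ => k (t - τ) * v τ) volume 0 t := fun hi => by
      have hi' : IntervalIntegrable (fun τ => k (t - τ) * v τ) volume 0 (t / 2) := hi.mono_set <| by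
        rw [uIcc_of_le ht2.le, uIcc_of_le ht.1.le]
        exact Icc_subset_Icc_right (by linarith)
      have hinv : ContinuousOn (fun τ => (k (t - τ))⁻¹) (uIcc 0 (t / 2)) :=
        (hkc.comp (by fun_prop) fun τ hτ => (hmem τ hτ).1).inv₀ fun τ hτ => hδk (hmem τ hτ)
      refine hnot (t / 2) ⟨ht2, by linarith⟩ ((hi'.continuousOn_mul hinv).congr fun τ hτ => ?_)
      exact inv_mul_cancel_left₀ (hδk (hmem τ (uIoc_subset_uIcc hτ))) _
    have := h t ⟨ht.1, htT⟩
    rwa [intervalIntegral.integral_undef hni, sub_zero] at this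
  refine hnot ε ⟨hε0, min_le_right _ _⟩
    ((intervalIntegrable_const (c := (1 : ℝ))).congr fun τ hτ => ?_)
  rw [uIoc_of_le hε0.le] at hτ
  exact (hone τ hτ).symm

theorem exact_source_term_VIE (α lam T : ℝ) (hα : 0 < α) (hα1 : α ≤ 1)
    (hlam : 1 < lam) (hT : 0 < T) :
    let w : ℝ → ℝ := fun t => (lam ^ 2 - mlE α 1 ((1 - lam ^ 2) * t ^ α)) / (lam ^ 2 - 1)
    ContinuousOn w (Ioc 0 T) ∧
    (∀ t ∈ Ioc (0:ℝ) T,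
      w t - ∫ τ in (0:ℝ)..t, (t - τ) ^ (α - 1) * mlE α α (-lam ^ 2 * (t - τ) ^ α) * w τ = 1) ∧
    (∀ v : ℝ → ℝ, ContinuousOn v (Ioc 0 T) →
      (∀ t ∈ Ioc (0:ℝ) T,
        v t - ∫ τ in (0:ℝ)..t, (t - τ) ^ (α - 1) * mlE α α (-lam ^ 2 * (t - τ) ^ α) * v τ = 1) →
      EqOn v w (Ioc 0 T)) := by
  intro w
  set k : ℝ → ℝ := fun s => s ^ (α - 1) * mlE α α (-lam ^ 2 * s ^ α) with hkdef
  have hlam2 : 0 < lam ^ 2 - 1 := by nlinarith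
  have hwc : Continuous w :=
    (continuous_const.sub (continuous_mlE_rpow hα (1 - lam ^ 2))).div_const _
  have hk : ∀ x y, IntervalIntegrable k volume x y := intervalIntegrable_rpow_mul_mlE hα _
  have hkc : ContinuousOn k (Ioi 0) :=
    (continuousOn_id.rpow_const fun s hs => Or.inl (ne_of_gt hs)).mul
      (continuous_mlE_rpow hα _).continuousOn
  have hk0 : ∀ᶠ s in 𝓝[>] 0, k s ≠ 0 := by
    have hφ : mlE α α (-lam ^ 2 * (0 : ℝ) ^ α) ≠ 0 := by
      rw [Real.zero_rpow hα.ne', mul_zero, mlE, tsum_eq_single 0 fun j hj => by simp [hj]]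
      simpa using (Real.Gamma_pos_of_pos hα).ne'
    have h1 := (continuous_mlE_rpow (β := α) hα (-lam ^ 2)).continuousAt.eventually_ne hφ
    filter_upwards [h1.filter_mono nhdsWithin_le_nhds, self_mem_nhdsWithin] with s hs hs0
    exact mul_ne_zero (Real.rpow_pos_of_pos hs0 _).ne' hs
  have hw : ∀ t ∈ Ioc (0 : ℝ) T, w t - ∫ τ in (0 : ℝ)..t, k (t - τ) * w τ = 1 := by
    intro t ht
    have hkt : ∀ {u : ℝ → ℝ}, Continuous u →
        IntervalIntegrable (fun τ => k (t - τ) * u τ) volume 0 t := fun hu =>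
      (intervalIntegrable_comp_sub_left hk).mul_continuousOn hu.continuousOn
    have h1 := sub_mul_integral_mlE hα ht.1 (-lam ^ 2) (1 - lam ^ 2)
    have h2 := sub_mul_integral_mlE hα ht.1 (-lam ^ 2) 0
    simp only [zero_mul, mlE_zero_right] at h2
    have hsplit : ∫ τ in (0 : ℝ)..t, k (t - τ) * w τ =
        (lam ^ 2 * (∫ τ in (0 : ℝ)..t, k (t - τ) * 1) -
          ∫ τ in (0 : ℝ)..t, k (t - τ) * mlE α 1 ((1 - lam ^ 2) * τ ^ α)) / (lam ^ 2 - 1) := by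
      rw [← intervalIntegral.integral_const_mul, ← intervalIntegral.integral_sub
        ((hkt continuous_const).const_mul _) (hkt (continuous_mlE_rpow hα _)),
        ← intervalIntegral.integral_div]
      refine intervalIntegral.integral_congr fun τ _ => ?_
      simp only [w]
      ring
    rw [hsplit]
    simp only [hkdef, w]
    rw [← sub_div, div_eq_one_iff_eq hlam2.ne']
    linear_combination h1 - h2
  refine ⟨hwc.continuousOn, hw, fun v hvc hv => ?_⟩
  have hvi := intervalIntegrable_of_volterra hT hkc hk0 hvc hv
  have hwi := hwc.intervalIntegrable (μ := volume) 0 T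
  have hzero := eqOn_zero_of_volterra (u := fun t => v t - w t) hT (hk 0 T) (hvi.sub hwi)
    fun t ht => by
      simp only [mul_sub]
      rw [intervalIntegral.integral_sub (intervalIntegrable_kernel_mul hk hkc hvc hvi ht)
        (intervalIntegrable_kernel_mul hk hkc hwc.continuousOn hwi ht)]
      linear_combination hv t ht - hw t ht
  exact fun t ht => sub_eq_zero.1 (hzero ht)
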